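/- Let n ≥ 2. There exists a bijection φ from Lat(P_{δ_n}) to the set of parking functions of length n−1 that is S_{n−1}-equivariant: for every permutation σ of {1,…,n−1} and every x ∈ Lat(P_{δ_n}), φ(σ·x) = σ·φ(x), where σ acts on x ∈ ℤ^n by permuting its first n−1 coordinates and fixing the n-th, and σ acts on a parking function by permuting its entries. (Consequently the permutation action of S_n on Lat(P_{δ_n}), restricted to S_{n−1}, is isomorphic to the parking function representation.) -/

import Mathlib

/-- The tuple `δ_n = (n-2, n-3, …, 1, 0, 0)`: its `i`-th coordinate (0-indexed) is
`n - 2 - i` (natural subtraction). -/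
def deltaTuple (n : ℕ) : Fin n → ℕ := fun i => n - 2 - (i : ℕ)

/-- The vertices of the permutahedron `P_{δ_n}`: all coordinate permutations of `δ_n`,
viewed as points of `ℝⁿ`. -/
def permutahedronVerts (n : ℕ) : Set (Fin n → ℝ) :=
  {y | ∃ σ : Equiv.Perm (Fin n), y = fun i => (deltaTuple n (σ i) : ℝ)}

/-- The lattice points of `P_{δ_n}`: integer points whose real image lies in the convex
hull of the coordinate permutations of `δ_n`. -/
def latticePts (n : ℕ) : Set (Fin n → ℤ) :=
  {x | (fun i => (x i : ℝ)) ∈ convexHull ℝ (permutahedronVerts n)}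

/-- A parking function of length `k`: a tuple `(a₁,…,a_k)` of nonnegative integers such
that for every `i ∈ {1,…,k}` at least `i` of its entries are `≤ i - 1`; 0-indexed,
for every `i : Fin k`, `#{j : a_j ≤ i} ≥ i + 1`. -/
def isParkingFn {k : ℕ} (a : Fin k → ℕ) : Prop :=
  ∀ i : Fin k, (i : ℕ) + 1 ≤ (Finset.univ.filter fun j => a j ≤ (i : ℕ)).card

/-- The action of a permutation `σ` of `{1,…,n-1}` on `x ∈ ℤⁿ` permuting the first
`n-1` coordinates and fixing the `n`-th. -/
def permAct (n : ℕ) (σ : Equiv.Perm (Fin (n - 1))) (x : Fin n → ℤ) : Fin n → ℤ :=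
  fun i => if h : (i : ℕ) < n - 1
    then x (Fin.castLE (Nat.sub_le n 1) (σ ⟨(i : ℕ), h⟩)) else x i

/-- Inequality description of the lattice points. -/
def IsBrk (k : ℕ) (x : Fin (k+1) → ℤ) : Prop :=
  2 * ∑ i, x i = (k:ℤ) * (k - 1) ∧
  ∀ A : Finset (Fin (k+1)), A.Nonempty → ((A.card:ℤ) - 1) * (A.card - 2) ≤ 2 * ∑ i ∈ A, x i

theorem nat_sum_lower (B : Finset ℕ) :
    B.Nonempty → ((B.card:ℤ) - 1) * (B.card - 2) ≤ 2 * ∑ b ∈ B, ((b - 1 : ℕ) : ℤ) := by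
  induction B using Finset.induction_on_max with
  | empty => simp
  | insert a s h ih =>
    intro _
    have ha : a ∉ s := fun hh => lt_irrefl _ (h a hh)
    rw [Finset.card_insert_of_notMem ha, Finset.sum_insert ha]
    have hc : s.card ≤ a := by
      have : s ⊆ Finset.range a := fun b hb => Finset.mem_range.2 (h b hb)
      simpa using Finset.card_le_card this
    rcases s.eq_empty_or_nonempty with rfl | hs
    · simp
    · have h1 := ih hs
      have h2 : 1 ≤ s.card := hs.card_pos
      have h3 : ((a - 1 : ℕ) : ℤ) = a - 1 := by omega
      rw [h3]
      push_cast
      have h4 : (s.card : ℤ) ≤ a := by exact_mod_cast hc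
      nlinarith

theorem sum_pred_range (k : ℕ) :
    2 * ∑ b ∈ Finset.range (k+1), ((b - 1 : ℕ) : ℤ) = (k:ℤ) * (k - 1) := by
  induction k with
  | zero => simp
  | succ m ih =>
    rw [Finset.sum_range_succ, mul_add, ih]
    push_cast
    simp
    ring

theorem delta_rev (k : ℕ) (j : Fin (k+1)) : deltaTuple (k+1) j = (Fin.rev j : ℕ) - 1 := by
  simp [deltaTuple, Fin.val_rev]; omega

theorem vert_isBrk (k : ℕ) (σ : Equiv.Perm (Fin (k+1))) :
    IsBrk k (fun i => (deltaTuple (k+1) (σ i) : ℤ)) := by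
  constructor
  · rw [Equiv.sum_comp σ (fun i => (deltaTuple (k+1) i : ℤ)),
      ← Equiv.sum_comp Fin.revPerm (fun i => (deltaTuple (k+1) i : ℤ)), ← sum_pred_range,
      Finset.sum_range]
    simp [delta_rev]
  · intro A hA
    have inj : Function.Injective (fun i => (Fin.rev (σ i) : ℕ)) := fun a b h => by
      simpa using Fin.rev_injective (Fin.val_injective h)
    have := nat_sum_lower (A.image (fun i => (Fin.rev (σ i) : ℕ))) (hA.image _)
    rw [Finset.card_image_of_injective _ inj, Finset.sum_image (fun a _ b _ h => inj h)] at this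
    simpa only [delta_rev] using this

theorem abel_nonneg (c z : ℕ → ℝ) (n : ℕ) (hc : ∀ i, i + 1 < n + 1 → c (i+1) ≤ c i)
    (hz : ∀ j, j ≤ n → 0 ≤ ∑ i ∈ Finset.range (j+1), z i) :
    c n * ∑ i ∈ Finset.range (n+1), z i ≤ ∑ i ∈ Finset.range (n+1), c i * z i := by
  induction n with
  | zero => simp
  | succ m ih =>
    have h1 := ih (fun i hi => hc i (by omega)) (fun j hj => hz j (by omega))
    rw [Finset.sum_range_succ, Finset.sum_range_succ _ (m+1)]
    have h2 := hz m (by omega)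
    have h3 := hc m (by omega)
    nlinarith

theorem brk_of_lattice (k : ℕ) (x : Fin (k+1) → ℤ) (hx : x ∈ latticePts (k+1)) : IsBrk k x := by
  have key : convexHull ℝ (permutahedronVerts (k+1)) ⊆
      {y | 2 * ∑ i, y i = (k:ℝ) * (k - 1) ∧
        ∀ A : Finset (Fin (k+1)), A.Nonempty →
          ((A.card:ℝ) - 1) * (A.card - 2) ≤ 2 * ∑ i ∈ A, y i} := by
    apply convexHull_min
    · rintro y ⟨σ, rfl⟩
      obtain ⟨h1, h2⟩ := vert_isBrk k σ
      refine ⟨?_, fun A hA => ?_⟩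
      · have := congrArg (Int.cast : ℤ → ℝ) h1
        push_cast at this
        exact this
      · have := (Int.cast_le (R := ℝ)).2 (h2 A hA)
        push_cast at this
        exact this
    · rintro y ⟨hy1, hy2⟩ z ⟨hz1, hz2⟩ a b ha hb hab
      have e : ∀ A : Finset (Fin (k+1)), 2 * ∑ i ∈ A, (a • y + b • z) i
          = a * (2 * ∑ i ∈ A, y i) + b * (2 * ∑ i ∈ A, z i) := by
        intro A
        simp only [Pi.add_apply, Pi.smul_apply, smul_eq_mul, Finset.sum_add_distrib,
          ← Finset.mul_sum]
        ring
      refine ⟨?_, fun A hA => ?_⟩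
      · rw [e, hy1, hz1, ← add_mul, hab, one_mul]
      · rw [e]
        have h1 := mul_le_mul_of_nonneg_left (hy2 A hA) ha
        have h2 := mul_le_mul_of_nonneg_left (hz2 A hA) hb
        have h3 : ((A.card:ℝ) - 1) * (A.card - 2) = a * (((A.card:ℝ) - 1) * (A.card - 2)) +
          b * (((A.card:ℝ) - 1) * (A.card - 2)) := by rw [← add_mul, hab, one_mul]
        linarith
  obtain ⟨h1, h2⟩ := key hx
  refine ⟨?_, fun A hA => ?_⟩
  · have h : ((2 * ∑ i, x i : ℤ) : ℝ) = ((k * (k - 1) : ℤ) : ℝ) := by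
      push_cast; exact h1
    exact Int.cast_injective h
  · have h : ((((A.card:ℤ) - 1) * (A.card - 2) : ℤ) : ℝ) ≤ ((2 * ∑ i ∈ A, x i : ℤ) : ℝ) := by
      push_cast; exact h2 A hA
    exact Int.cast_le.1 h

theorem verts_finite (n : ℕ) : (permutahedronVerts n).Finite := by
  have : permutahedronVerts n =
      Set.range (fun σ : Equiv.Perm (Fin n) => fun i => (deltaTuple n (σ i) : ℝ)) := by
    ext y; simp [permutahedronVerts, eq_comm]
  rw [this]; exact Set.finite_range _

theorem lattice_of_brk (k : ℕ) (x : Fin (k+1) → ℤ) (hx : IsBrk k x) : x ∈ latticePts (k+1) := by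
  by_contra hcon
  obtain ⟨f, u, hfu, hfv⟩ := geometric_hahn_banach_point_closed
    (convex_convexHull ℝ (permutahedronVerts (k+1)))
    ((verts_finite (k+1)).isCompact_convexHull ℝ).isClosed hcon
  set c : Fin (k+1) → ℝ := fun i => f (Pi.single i 1) with hcdef
  have hf : ∀ y : Fin (k+1) → ℝ, f y = ∑ i, c i * y i := by
    intro y
    conv_lhs => rw [pi_eq_sum_univ' y]
    rw [map_sum]
    refine Finset.sum_congr rfl fun i _ => ?_
    rw [map_smul, smul_eq_mul, mul_comm]
  set τ := Tuple.sort (fun i => - c i) with hτ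
  have hmono : Monotone ((fun i => - c i) ∘ τ) := Tuple.monotone_sort _
  -- vertex
  have hv := hfv _ (subset_convexHull ℝ _ ⟨τ.symm.trans Fin.revPerm, rfl⟩)
  rw [hf, ← Equiv.sum_comp τ] at hv
  rw [hf, ← Equiv.sum_comp τ] at hfu
  simp only [Equiv.trans_apply, Equiv.symm_apply_apply, Fin.revPerm_apply, delta_rev,
    Fin.rev_rev] at hv
  -- natural-number indexed versions
  let C : ℕ → ℝ := fun i => if h : i < k+1 then c (τ ⟨i, h⟩) else 0
  let X : ℕ → ℤ := fun i => if h : i < k+1 then x (τ ⟨i, h⟩) else 0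
  let Z : ℕ → ℝ := fun i => ((X i - ((i - 1 : ℕ) : ℤ) : ℤ) : ℝ)
  have hXi : ∀ i : Fin (k+1), X i = x (τ i) := fun i => dif_pos i.2
  have hCi : ∀ i : Fin (k+1), C i = c (τ i) := fun i => dif_pos i.2
  have hX : ∀ j, j ≤ k → ∑ i ∈ Finset.range (j+1), X i =
      ∑ i ∈ (Finset.univ.filter (fun i : Fin (k+1) => (i:ℕ) < j+1)).map τ.toEmbedding, x i := by
    intro j hj
    rw [Finset.sum_map]
    symm
    refine Finset.sum_bij (fun i _ => (i:ℕ)) ?_ ?_ ?_ ?_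
    · intro a ha; simpa using ha
    · intro a _ b _ h; exact Fin.ext h
    · intro b hb
      have hb' := Finset.mem_range.1 hb
      exact ⟨⟨b, by omega⟩, by simpa using hb', rfl⟩
    · intro a _; simp [hXi]
  have hcard : ∀ j, j ≤ k →
      (Finset.univ.filter (fun i : Fin (k+1) => (i:ℕ) < j+1)).card = j+1 := by
    intro j hj
    have := Fin.card_filter_val_lt (n := k+1) (m := j+1)
    rw [this]; omega
  have hZsum : ∀ j, j ≤ k → 0 ≤ ∑ i ∈ Finset.range (j+1), Z i := by
    intro j hj
    have h1 := hx.2 ((Finset.univ.filter (fun i : Fin (k+1) => (i:ℕ) < j+1)).map τ.toEmbedding)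
      (by rw [← Finset.card_pos, Finset.card_map, hcard j hj]; omega)
    rw [Finset.card_map, hcard j hj, ← hX j hj] at h1
    have h2 := sum_pred_range j
    have h3 : (0:ℤ) ≤ ∑ i ∈ Finset.range (j+1), (X i - ((i - 1 : ℕ) : ℤ)) := by
      rw [Finset.sum_sub_distrib]
      push_cast at h1
      nlinarith
    have h4 : ((0:ℤ):ℝ) ≤ ((∑ i ∈ Finset.range (j+1), (X i - ((i - 1 : ℕ) : ℤ)) : ℤ) : ℝ) := by
      exact_mod_cast h3
    rw [Int.cast_sum] at h4
    simpa [Z] using h4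
  have hZtot : ∑ i ∈ Finset.range (k+1), Z i = 0 := by
    have h0 : ∑ i ∈ Finset.range (k+1), X i = ∑ i, x i := by
      rw [Finset.sum_range, ← Equiv.sum_comp τ x]
      simp [hXi]
    have h2 := sum_pred_range k
    have h1 := hx.1
    have h3 : ∑ i ∈ Finset.range (k+1), (X i - ((i - 1 : ℕ) : ℤ)) = 0 := by
      rw [Finset.sum_sub_distrib, h0]
      linarith
    have h4 : ((∑ i ∈ Finset.range (k+1), (X i - ((i - 1 : ℕ) : ℤ)) : ℤ) : ℝ) = 0 := by
      rw [h3]; simp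
    rw [Int.cast_sum] at h4
    exact h4
  have habel := abel_nonneg C Z k (by
    intro i hi
    have hle : (⟨i, by omega⟩ : Fin (k+1)) ≤ ⟨i+1, hi⟩ := by simp
    have := hmono hle
    simp only [Function.comp] at this
    have h5 : i < k + 1 := by omega
    simp only [C, hi, h5, dif_pos]
    linarith) hZsum
  rw [hZtot, mul_zero, Finset.sum_range] at habel
  have hfin : ∑ i : Fin (k+1), C i * Z i =
      ∑ i, c (τ i) * (x (τ i) : ℝ) - ∑ i : Fin (k+1), c (τ i) * (((i:ℕ) - 1 : ℕ) : ℝ) := by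
    rw [← Finset.sum_sub_distrib]
    refine Finset.sum_congr rfl fun i _ => ?_
    simp [hCi, Z, hXi, mul_sub]
  rw [hfin] at habel
  linarith

/-- Uniqueness of break divisors in a class. -/
theorem brk_unique (k : ℕ) (x y m : Fin (k+1) → ℤ) (hx : IsBrk k x) (hy : IsBrk k y)
    (h : ∀ i, y i = x i + (k+1) * m i - ∑ j, m j) : y = x := by
  obtain ⟨i₀, -, hi₀⟩ := Finset.exists_max_image Finset.univ m Finset.univ_nonempty
  set M := m i₀ with hM
  set A := Finset.univ.filter (fun i => m i = M) with hA
  have hAne : A.Nonempty := ⟨i₀, by simp [hA, hM]⟩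
  have hsplit : ∑ j, m j = A.card * M + ∑ j ∈ Aᶜ, m j := by
    rw [← Finset.sum_add_sum_compl A m]
    congr 1
    rw [Finset.sum_congr rfl (g := fun _ => M) (fun i hi => (Finset.mem_filter.1 hi).2),
      Finset.sum_const, nsmul_eq_mul]
  have hcc : (A.card : ℤ) + (Aᶜ.card : ℤ) = k + 1 := by
    have := Finset.card_add_card_compl A
    rw [Fintype.card_fin] at this
    exact_mod_cast this
  have hle : ∑ j ∈ Aᶜ, m j ≤ Aᶜ.card * (M - 1) := by
    have := Finset.sum_le_card_nsmul Aᶜ m (M-1) (fun i hi => by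
      have h1 := hi₀ i (Finset.mem_univ _)
      have h2 : m i ≠ M := by simpa [hA] using hi
      omega)
    simpa using this
  have hyA : ∑ i ∈ A, y i = ∑ i ∈ A, x i + A.card * ((k+1) * M - ∑ j, m j) := by
    rw [Finset.sum_congr rfl (g := fun i => x i + ((k+1) * M - ∑ j, m j)) (fun i hi => by
      rw [h i, (Finset.mem_filter.1 hi).2]; ring), Finset.sum_add_distrib,
      Finset.sum_const, nsmul_eq_mul]
  rcases Aᶜ.eq_empty_or_nonempty with he | hne
  · have hall : ∀ i, m i = M := by
      intro i
      have : i ∉ Aᶜ := by simp [he]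
      simpa [hA] using this
    funext i
    rw [h i]
    simp [hall]
  · exfalso
    have h1 := hx.2 A hAne
    have h2 := hy.2 Aᶜ hne
    have h3 := hy.1
    rw [← Finset.sum_add_sum_compl A y] at h3
    have h4 : (Aᶜ.card:ℤ) ≤ (k+1) * M - ∑ j, m j := by
      rw [hsplit, ← hcc]; nlinarith
    have h5 : (1:ℤ) ≤ A.card := by exact_mod_cast hAne.card_pos
    have h6 := mul_le_mul_of_nonneg_left h4 (by linarith : (0:ℤ) ≤ A.card)
    have h7 : (k:ℤ) = A.card + Aᶜ.card - 1 := by linarith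
    rw [h7] at h3
    generalize (A.card : ℤ) = a at *
    generalize (Aᶜ.card : ℤ) = b at *
    nlinarith

theorem brk_exists (k : ℕ) (x : Fin (k+1) → ℤ) (hx : 2 * ∑ i, x i = (k:ℤ) * (k - 1)) :
    ∃ m : Fin (k+1) → ℤ, IsBrk k (fun i => x i + (k+1) * m i - ∑ j, m j) := by
  let Y : (Fin (k+1) → ℤ) → Fin (k+1) → ℤ := fun m i => x i + (k+1) * m i - ∑ j, m j
  let N : (Fin (k+1) → ℤ) → ℕ := fun m => (∑ i, Y m i ^ 2).toNat
  have hsum : ∀ m, ∑ i, Y m i = ∑ i, x i := by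
    intro m
    simp only [Y, Finset.sum_sub_distrib, Finset.sum_add_distrib, ← Finset.mul_sum]
    simp
  obtain ⟨m, hm⟩ : ∃ m, ∀ m', N m ≤ N m' :=
    ⟨Function.argmin N, fun m' => Function.argmin_le N m'⟩
  refine ⟨m, (by rw [← hx]; congr 1; exact hsum m), fun A hA => ?_⟩
  change _ ≤ 2 * ∑ i ∈ A, Y m i
  let v : Fin (k+1) → ℤ := fun i => (k+1) * (if i ∈ A then 1 else 0) - A.card
  have hYv : ∀ i, Y (fun i => m i + if i ∈ A then 1 else 0) i = Y m i + v i := by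
    intro i
    have hc : ∑ i, (if i ∈ A then (1:ℤ) else 0) = A.card := by simp
    simp only [Y, v, Finset.sum_add_distrib, hc]
    ring
  have h1 := hm (fun i => m i + if i ∈ A then 1 else 0)
  have nn : ∀ m, 0 ≤ ∑ i, Y m i ^ 2 := fun m => Finset.sum_nonneg fun i _ => sq_nonneg _
  have h2 : ∑ i, Y m i ^ 2 ≤ ∑ i, (Y m i + v i) ^ 2 := by
    have a1 := nn m
    have a2 := nn (fun i => m i + if i ∈ A then 1 else 0)
    simp only [N] at h1
    simp only [← hYv]
    omega
  have h3 : ∑ i, (Y m i + v i) ^ 2 = ∑ i, Y m i ^ 2 + 2 * ((k+1) * ∑ i ∈ A, Y m i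
      - A.card * ∑ i, Y m i) + ((k+1)^2 * A.card - 2 * (k+1) * A.card * A.card
      + (k+1) * A.card ^ 2) := by
    have e : ∀ i, (Y m i + v i) ^ 2 = Y m i ^ 2 + 2 * ((k+1) * (if i ∈ A then Y m i else 0)
        - A.card * Y m i) + ((k+1)^2 * (if i ∈ A then 1 else 0)
        - 2 * (k+1) * A.card * (if i ∈ A then 1 else 0) + A.card ^ 2) := by
      intro i
      simp only [v]
      split_ifs <;> ring
    simp only [e, Finset.sum_add_distrib, Finset.sum_sub_distrib, ← Finset.mul_sum]
    simp
  rw [h3, hsum] at h2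
  have hpos : (1:ℤ) ≤ A.card := by exact_mod_cast hA.card_pos
  generalize (A.card : ℤ) = a at *
  generalize ∑ i ∈ A, Y m i = S at *
  have h4 : (k+1:ℤ) * (a * (a - 3)) < (k+1) * (2 * S) := by nlinarith
  have h5 : a * (a-3) < 2 * S := lt_of_mul_lt_mul_left h4 (by positivity)
  have h6 : Even (a * (a - 3)) := by
    rcases Int.even_or_odd a with h | h
    · exact h.mul_right _
    · exact (h.sub_odd (by decide)).mul_left _
  obtain ⟨t, ht⟩ := h6
  have : (a - 1) * (a - 2) = a * (a - 3) + 2 := by ring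
  omega

/-- `a` and `z` agree modulo `k+1` up to a common shift. -/
def ShiftRel (k : ℕ) (a : Fin k → ℕ) (z : Fin k → ℤ) : Prop :=
  ∃ c : ℤ, ∀ i, ((k:ℤ)+1) ∣ (a i : ℤ) - z i - c

theorem park_exists (k : ℕ) (z : Fin k → ℤ) : ∃ a, isParkingFn a ∧ ShiftRel k a z := by
  have hk : (0:ℤ) < k + 1 := by positivity
  let a : ℤ → Fin k → ℕ := fun c i => ((z i + c) % (k+1)).toNat
  have ha : ∀ c i, (a c i : ℤ) = (z i + c) % (k+1) := fun c i =>
    Int.toNat_of_nonneg (Int.emod_nonneg _ hk.ne')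
  obtain ⟨c, hc⟩ : ∃ c, ∀ c', ∑ i, a c i ≤ ∑ i, a c' i :=
    ⟨Function.argmin (fun c => ∑ i, a c i), fun c' => Function.argmin_le (fun c => ∑ i, a c i) c'⟩
  refine ⟨a c, fun s => ?_, c, fun i => ?_⟩
  · have h1 := hc (c - (s + 1))
    have h2 : ∀ i, (a (c - (s+1)) i : ℤ) =
        a c i - (s + 1) + (k+1) * (if a c i ≤ (s:ℕ) then 1 else 0) := by
      intro i
      have e1 : z i + (c - (s+1)) = z i + c - (s+1) := by ring
      have hs : ((s:ℕ):ℤ) < k := by exact_mod_cast s.2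
      rw [ha, e1, Int.sub_emod, ← ha, Int.emod_eq_of_lt (a := ((s:ℕ):ℤ)+1) (by positivity)
        (by linarith)]
      have h0 : (a c i : ℤ) < k + 1 := by rw [ha]; exact Int.emod_lt_of_pos _ hk
      split_ifs with h
      · rw [← Int.add_emod_right, Int.emod_eq_of_lt] <;> [ring; omega; omega]
      · rw [Int.emod_eq_of_lt] <;> [ring; omega; omega]
    have h3 : ((∑ i, a c i : ℕ):ℤ) ≤ ((∑ i, a (c - (s+1)) i : ℕ) : ℤ) := by exact_mod_cast h1
    push_cast at h3
    simp only [h2, Finset.sum_add_distrib, Finset.sum_sub_distrib, ← Finset.mul_sum] at h3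
    simp at h3
    have hs : ((s:ℕ):ℤ) < k := by exact_mod_cast s.2
    by_contra hlt
    have hlt' : ((Finset.univ.filter fun j => a c j ≤ (s : ℕ)).card : ℤ) ≤ s := by
      exact_mod_cast (by omega)
    nlinarith
  · rw [ha]
    have := Int.emod_add_mul_ediv (z i + c) (k+1)
    exact ⟨-((z i + c) / (k+1)), by linarith⟩

theorem park_lt (k : ℕ) (a : Fin k → ℕ) (ha : isParkingFn a) (i : Fin k) : a i < k := by
  have hk : 0 < k := i.pos
  have h := ha ⟨k-1, by omega⟩
  simp only at h
  have h2 : (Finset.univ.filter fun j => a j ≤ k - 1) = Finset.univ := by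
    apply Finset.eq_univ_of_card
    have := Finset.card_le_univ (Finset.univ.filter fun j => a j ≤ k - 1)
    simp at this ⊢
    omega
  have := Finset.mem_univ i
  rw [← h2] at this
  have := (Finset.mem_filter.1 this).2
  omega

theorem park_unique (k : ℕ) (a b : Fin k → ℕ) (ha : isParkingFn a) (hb : isParkingFn b)
    (z : Fin k → ℤ) (haz : ShiftRel k a z) (hbz : ShiftRel k b z) : a = b := by
  have hk : (0:ℤ) < k + 1 := by positivity
  obtain ⟨c, hc⟩ := haz
  obtain ⟨d, hd⟩ := hbz
  set e := (d - c) % (k+1) with he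
  have he0 : 0 ≤ e := Int.emod_nonneg _ hk.ne'
  have he1 : e < k + 1 := Int.emod_lt_of_pos _ hk
  have hde := Int.emod_add_mul_ediv (d - c) (k+1)
  rw [← he] at hde
  have hab : ∀ i, ((k:ℤ)+1) ∣ (b i : ℤ) - a i - e := by
    intro i
    obtain ⟨u, hu⟩ := hc i
    obtain ⟨w, hw⟩ := hd i
    exact ⟨w - u + (d-c)/(k+1), by linarith⟩
  clear_value e
  have cases : ∀ i, (b i : ℤ) = a i + e ∨ (b i : ℤ) = a i + e - (k+1) := by
    intro i
    obtain ⟨u, hu⟩ := hab i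
    have h1 := park_lt k a ha i
    have h2 := park_lt k b hb i
    have h3 : -2 < u := by
      by_contra hh
      nlinarith
    have h4 : u < 1 := by
      by_contra hh
      nlinarith
    have : u = 0 ∨ u = -1 := by omega
    rcases this with rfl | rfl
    · left; linarith
    · right; linarith
  lift e to ℕ using he0
  rcases Nat.eq_zero_or_pos e with rfl | hpos
  · funext i
    have h1 := park_lt k a ha i
    have h2 := park_lt k b hb i
    rcases cases i with h | h <;> omega
  · exfalso
    have h1 := hb ⟨e - 1, by omega⟩
    rcases Nat.lt_or_ge (k - e) k with hlt | hge
    swap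
    · omega
    have h2 := ha ⟨k - e, hlt⟩
    simp only at h1 h2
    have hsub : (Finset.univ.filter fun j => b j ≤ e - 1) ⊆
        (Finset.univ.filter fun j => a j ≤ k - e)ᶜ := by
      intro j hj
      simp at hj ⊢
      rcases cases j with h | h <;> omega
    have h3 := Finset.card_le_card hsub
    rw [Finset.card_compl] at h3
    simp at h3
    omega

theorem park_perm (k : ℕ) (a : Fin k → ℕ) (ha : isParkingFn a) (σ : Equiv.Perm (Fin k)) :
    isParkingFn (a ∘ σ) := by
  intro i
  refine (ha i).trans (le_of_eq ?_)
  symm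
  refine Finset.card_bij (fun j _ => σ j) ?_ ?_ ?_
  · intro j hj; simpa using hj
  · intro _ _ _ _ h; exact σ.injective h
  · intro b hb; exact ⟨σ.symm b, by simpa using hb, by simp⟩

theorem permAct_castSucc (k : ℕ) (σ : Equiv.Perm (Fin k)) (x : Fin (k+1) → ℤ) (i : Fin k) :
    permAct (k+1) σ x i.castSucc = x (σ i).castSucc := by
  simp [permAct]
  rfl

theorem main_aux (k : ℕ) :
    ∃ φ : (Fin (k+1) → ℤ) → (Fin k → ℕ),
      Set.BijOn φ (latticePts (k+1)) {a | isParkingFn a} ∧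
      ∀ σ : Equiv.Perm (Fin k), ∀ x ∈ latticePts (k+1),
        φ (permAct (k+1) σ x) = (φ x) ∘ ⇑σ := by
  choose P hP hR using park_exists k
  refine ⟨fun x => P (fun i => x i.castSucc), ⟨fun x _ => hP _, ?_, ?_⟩, ?_⟩
  · intro x hx y hy hxy
    have hx' := brk_of_lattice k x hx
    have hy' := brk_of_lattice k y hy
    have h1 := hR (fun i => x i.castSucc)
    have h2 := hR (fun i => y i.castSucc)
    simp only at hxy
    rw [hxy] at h1
    obtain ⟨c, hc⟩ := h1
    obtain ⟨d, hd⟩ := h2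
    have : ∀ i : Fin k, ∃ m : ℤ, x i.castSucc = y i.castSucc + (k+1) * m - (c - d) := by
      intro i
      obtain ⟨u, hu⟩ := hc i
      obtain ⟨w, hw⟩ := hd i
      exact ⟨w - u, by linarith⟩
    choose m hm using this
    have hs : ∑ i, (Fin.snoc m ((c-d) - ∑ i, m i) : Fin (k+1) → ℤ) i = c - d := by
      rw [Fin.sum_univ_castSucc]; simp
    refine brk_unique k y x (Fin.snoc m ((c-d) - ∑ i, m i) : Fin (k+1) → ℤ) hy' hx' ?_
    rw [hs]
    intro i
    refine Fin.lastCases ?_ (fun j => ?_) i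
    · have e1 := hx'.1
      have e2 := hy'.1
      rw [Fin.sum_univ_castSucc] at e1 e2
      simp only [hm, Finset.sum_sub_distrib, Finset.sum_add_distrib, ← Finset.mul_sum] at e1
      simp at e1
      simp
      linarith
    · simp [hm]
  · intro a ha
    have hev : Even ((k:ℤ) * (k - 1)) := Int.even_mul_pred_self _
    obtain ⟨g, hg⟩ := hev
    obtain ⟨m, hm⟩ := brk_exists k (Fin.snoc (fun i => (a i : ℤ)) (g - ∑ i, (a i : ℤ)) :
      Fin (k+1) → ℤ) (by rw [Fin.sum_univ_castSucc]; simp; linarith)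
    refine ⟨_, lattice_of_brk k _ hm, ?_⟩
    refine park_unique k _ _ (hP _) ha _ (hR _) ⟨∑ j, m j, fun i => ⟨-m i.castSucc, ?_⟩⟩
    simp
    ring
  · intro σ x _
    refine park_unique k _ _ (hP _) (park_perm k _ (hP _) σ) _ (hR _) ?_
    obtain ⟨c, hc⟩ := hR (fun i => x i.castSucc)
    refine ⟨c, fun i => ?_⟩
    have := hc (σ i)
    simp only [permAct_castSucc]
    exact this

/-- There is an `S_{n-1}`-equivariant bijection from the lattice points of `P_{δ_n}`
onto the parking functions of length `n-1`. -/
theorem equivariant_bijection_parking (n : ℕ) (hn : 2 ≤ n) :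
    ∃ φ : (Fin n → ℤ) → (Fin (n - 1) → ℕ),
      Set.BijOn φ (latticePts n) {a | isParkingFn a} ∧
      ∀ σ : Equiv.Perm (Fin (n - 1)), ∀ x ∈ latticePts n,
        φ (permAct n σ x) = (φ x) ∘ ⇑σ := by
  obtain ⟨k, rfl⟩ : ∃ k, n = k + 1 := ⟨n - 1, by omega⟩
  exact main_aux k
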